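/- Let f : [0,∞) → ℝ be operator convex, let L_1,…,L_n be positive operators on H and R_1,…,R_n strictly positive operators on H, and let {1,…,n} = S_1 ∪ S_2 be a partition into two disjoint nonempty sets. Put A = ∑_{i=1}^n L_i, B = ∑_{i=1}^n R_i, A_{S_k} = ∑_{i∈S_k} L_i, B_{S_k} = ∑_{i∈S_k} R_i (k = 1,2), and assume each B_{S_k} is invertible. Then 2·g(A/2, B/2) ≤ g(A_{S_1},B_{S_1}) + g(A_{S_2},B_{S_2}) ≤ ∑_{i=1}^n g(L_i,R_i) in the Loewner order. -/

import Mathlib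

open scoped InnerProductSpace

noncomputable section

/-- A continuous function `f : [0, ∞) → ℝ` is *operator convex* if for every complex Hilbert
space `K`, all selfadjoint operators `A, B` on `K` with spectra in `[0, ∞)` and every
`λ ∈ [0, 1]` one has `f(λA + (1-λ)B) ≤ λ f(A) + (1-λ) f(B)` in the Loewner order, where
`f(A)` is given by the continuous functional calculus. -/
def OperatorConvexOn (f : ℝ → ℝ) : Prop :=
  ∀ (K : Type) [NormedAddCommGroup K] [InnerProductSpace ℂ K] [CompleteSpace K],
    ∀ A B : K →L[ℂ] K, IsSelfAdjoint A → IsSelfAdjoint B →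
      spectrum ℝ A ⊆ Set.Ici (0 : ℝ) → spectrum ℝ B ⊆ Set.Ici (0 : ℝ) →
      ∀ lam : ℝ, lam ∈ Set.Icc (0 : ℝ) 1 →
        cfc f (lam • A + (1 - lam) • B) ≤ lam • cfc f A + (1 - lam) • cfc f B

variable {H : Type} [NormedAddCommGroup H] [InnerProductSpace ℂ H] [CompleteSpace H]

/-- `R^{1/2}` via the continuous functional calculus. -/
def opSqrt (R : H →L[ℂ] H) : H →L[ℂ] H := cfc Real.sqrt R

/-- `R^{-1/2}` via the continuous functional calculus. -/
def opInvSqrt (R : H →L[ℂ] H) : H →L[ℂ] H := cfc (fun t : ℝ => (Real.sqrt t)⁻¹) R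

/-- The non-commutative perspective `g(L, R) = R^{1/2} f(R^{-1/2} L R^{-1/2}) R^{1/2}`. -/
def persp (f : ℝ → ℝ) (L R : H →L[ℂ] H) : H →L[ℂ] H :=
  opSqrt R * cfc f (opInvSqrt R * L * opInvSqrt R) * opSqrt R

theorem spectrum_subset_Ici {E : Type} [NormedAddCommGroup E] [InnerProductSpace ℂ E]
    [CompleteSpace E] {A : E →L[ℂ] E} (hA : 0 ≤ A) : spectrum ℝ A ⊆ Set.Ici (0 : ℝ) :=
  fun _ hx => spectrum_nonneg_of_nonneg hA hx

section BlockOperators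

variable {E F : Type} [NormedAddCommGroup E] [InnerProductSpace ℂ E]
  [NormedAddCommGroup F] [InnerProductSpace ℂ F]

/-- The inclusion of the first summand of an orthogonal direct sum. -/
def inlL2 (E F : Type) [NormedAddCommGroup E] [InnerProductSpace ℂ E]
    [NormedAddCommGroup F] [InnerProductSpace ℂ F] : E →L[ℂ] WithLp 2 (E × F) :=
  (WithLp.prodContinuousLinearEquiv 2 ℂ E F).symm ∘L ContinuousLinearMap.inl ℂ E F

/-- The inclusion of the second summand of an orthogonal direct sum. -/
def inrL2 (E F : Type) [NormedAddCommGroup E] [InnerProductSpace ℂ E]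
    [NormedAddCommGroup F] [InnerProductSpace ℂ F] : F →L[ℂ] WithLp 2 (E × F) :=
  (WithLp.prodContinuousLinearEquiv 2 ℂ E F).symm ∘L ContinuousLinearMap.inr ℂ E F

@[simp] theorem inlL2_apply (x : E) : inlL2 E F x = WithLp.toLp 2 (x, 0) := rfl

@[simp] theorem inrL2_apply (y : F) : inrL2 E F y = WithLp.toLp 2 (0, y) := rfl

/-- The block operator `(x, y) ↦ (a x + b y, c x + d y)`. -/
def blockOp (a : E →L[ℂ] E) (b : F →L[ℂ] E) (c : E →L[ℂ] F) (d : F →L[ℂ] F) :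
    WithLp 2 (E × F) →L[ℂ] WithLp 2 (E × F) :=
  inlL2 E F ∘L (a ∘L WithLp.fstL 2 ℂ E F + b ∘L WithLp.sndL 2 ℂ E F) +
    inrL2 E F ∘L (c ∘L WithLp.fstL 2 ℂ E F + d ∘L WithLp.sndL 2 ℂ E F)

theorem blockOp_apply (a : E →L[ℂ] E) (b : F →L[ℂ] E) (c : E →L[ℂ] F) (d : F →L[ℂ] F)
    (z : WithLp 2 (E × F)) :
    blockOp a b c d z = WithLp.toLp 2 (a z.fst + b z.snd, c z.fst + d z.snd) := by
  simp [blockOp, ← WithLp.toLp_add]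

theorem blockOp_mul (a a' : E →L[ℂ] E) (b b' : F →L[ℂ] E) (c c' : E →L[ℂ] F)
    (d d' : F →L[ℂ] F) :
    blockOp a b c d * blockOp a' b' c' d' =
      blockOp (a ∘L a' + b ∘L c') (a ∘L b' + b ∘L d') (c ∘L a' + d ∘L c')
        (c ∘L b' + d ∘L d') := by
  refine ContinuousLinearMap.ext fun z => ?_
  simp only [mul_apply_eq_comp, blockOp_apply, add_apply,
    ContinuousLinearMap.comp_apply, WithLp.toLp_fst, WithLp.toLp_snd, map_add]
  congr 2 <;> abel

theorem blockOp_one : blockOp (1 : E →L[ℂ] E) 0 0 (1 : F →L[ℂ] F) = 1 := by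
  ext z : 1; apply WithLp.ofLp_injective; ext <;> simp [blockOp_apply]

theorem blockOp_add (a a' : E →L[ℂ] E) (b b' : F →L[ℂ] E) (c c' : E →L[ℂ] F)
    (d d' : F →L[ℂ] F) :
    blockOp a b c d + blockOp a' b' c' d' = blockOp (a + a') (b + b') (c + c') (d + d') := by
  ext z : 1; apply WithLp.ofLp_injective; ext <;> simp [blockOp_apply] <;> abel

theorem blockOp_smul (r : ℝ) (a : E →L[ℂ] E) (b : F →L[ℂ] E) (c : E →L[ℂ] F)
    (d : F →L[ℂ] F) :
    r • blockOp a b c d = blockOp (r • a) (r • b) (r • c) (r • d) := by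
  ext z : 1; apply WithLp.ofLp_injective; ext <;> simp [blockOp_apply]

variable [CompleteSpace E] [CompleteSpace F]

@[simp] theorem adjoint_inlL2 :
    ContinuousLinearMap.adjoint (inlL2 E F) = WithLp.fstL 2 ℂ E F := by
  symm
  rw [ContinuousLinearMap.eq_adjoint_iff]
  intro x y
  simp [WithLp.prod_inner_apply]

@[simp] theorem adjoint_inrL2 :
    ContinuousLinearMap.adjoint (inrL2 E F) = WithLp.sndL 2 ℂ E F := by
  symm
  rw [ContinuousLinearMap.eq_adjoint_iff]
  intro x y
  simp [WithLp.prod_inner_apply]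

theorem star_blockOp (a : E →L[ℂ] E) (b : F →L[ℂ] E) (c : E →L[ℂ] F) (d : F →L[ℂ] F) :
    star (blockOp a b c d) = blockOp (star a) (ContinuousLinearMap.adjoint c)
      (ContinuousLinearMap.adjoint b) (star d) := by
  symm
  rw [ContinuousLinearMap.star_eq_adjoint (blockOp a b c d), ContinuousLinearMap.eq_adjoint_iff]
  intro x y
  simp [blockOp_apply, WithLp.prod_inner_apply, ContinuousLinearMap.star_eq_adjoint,
    ContinuousLinearMap.adjoint_inner_left, inner_add_left, inner_add_right]
  ring

/-- The block-diagonal embedding as a `⋆`-algebra homomorphism. -/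
def blockDiag (E F : Type) [NormedAddCommGroup E] [InnerProductSpace ℂ E] [CompleteSpace E]
    [NormedAddCommGroup F] [InnerProductSpace ℂ F] [CompleteSpace F] :
    ((E →L[ℂ] E) × (F →L[ℂ] F)) →⋆ₐ[ℂ] (WithLp 2 (E × F) →L[ℂ] WithLp 2 (E × F)) where
  toFun p := blockOp p.1 0 0 p.2
  map_one' := blockOp_one
  map_mul' p q := by rw [blockOp_mul]; simp [ContinuousLinearMap.mul_def]
  map_zero' := by ext z : 1; apply WithLp.ofLp_injective; ext <;> simp [blockOp_apply]
  map_add' p q := by ext z : 1; apply WithLp.ofLp_injective; ext <;> simp [blockOp_apply]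
  commutes' r := by ext z : 1; apply WithLp.ofLp_injective; ext <;> simp [blockOp_apply, Algebra.algebraMap_eq_smul_one]
  map_star' p := by rw [star_blockOp]; simp

theorem blockDiag_apply (X : E →L[ℂ] E) (Y : F →L[ℂ] F) :
    blockDiag E F (X, Y) = blockOp X 0 0 Y := rfl

theorem continuous_blockDiag : Continuous (blockDiag E F) := by
  change Continuous fun p : (E →L[ℂ] E) × (F →L[ℂ] F) => blockOp p.1 0 0 p.2
  unfold blockOp
  fun_prop

theorem isSelfAdjoint_blockOp_diag {X : E →L[ℂ] E} {Y : F →L[ℂ] F} (hX : IsSelfAdjoint X)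
    (hY : IsSelfAdjoint Y) : IsSelfAdjoint (blockOp X 0 0 Y) := by
  rw [isSelfAdjoint_iff, star_blockOp, hX.star_eq, hY.star_eq]
  simp

theorem cfc_blockOp_diag {f : ℝ → ℝ} {X : E →L[ℂ] E} {Y : F →L[ℂ] F} (hX : IsSelfAdjoint X)
    (hY : IsSelfAdjoint Y) (hf : ContinuousOn f (spectrum ℝ X ∪ spectrum ℝ Y)) :
    cfc f (blockOp X 0 0 Y) = blockOp (cfc f X) 0 0 (cfc f Y) := by
  let : CStarAlgebra (E →L[ℂ] E) := {}
  let : CStarAlgebra (F →L[ℂ] F) := {}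
  have : ContinuousFunctionalCalculus ℝ ((E →L[ℂ] E) × (F →L[ℂ] F)) IsSelfAdjoint :=
    IsSelfAdjoint.instContinuousFunctionalCalculus
  have hXY : IsSelfAdjoint (X, Y) := Prod.ext hX.star_eq hY.star_eq
  rw [← blockDiag_apply, ← blockDiag_apply,
    ← cfc_map_prod (S := ℂ) f X Y hf hXY hX hY]
  refine (StarAlgHom.map_cfc (blockDiag E F) f (X, Y) ?_ continuous_blockDiag hXY ?_).symm
  · rwa [Prod.spectrum_eq]
  · exact isSelfAdjoint_blockOp_diag hX hY

theorem blockOp_diag_nonneg {X : E →L[ℂ] E} {Y : F →L[ℂ] F} (hX : 0 ≤ X) (hY : 0 ≤ Y) :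
    0 ≤ blockOp X 0 0 Y := by
  rw [ContinuousLinearMap.nonneg_iff_isPositive] at hX hY ⊢
  have h := (hX.conj_adjoint (inlL2 E F)).add (hY.conj_adjoint (inrL2 E F))
  convert h using 1
  simp [blockOp]

/-- The Loewner order on block operators passes to the lower right corners. -/
theorem le_of_blockOp_le {a a' : E →L[ℂ] E} {b b' : F →L[ℂ] E} {c c' : E →L[ℂ] F}
    {d d' : F →L[ℂ] F} (h : blockOp a b c d ≤ blockOp a' b' c' d') : d ≤ d' := by
  rw [ContinuousLinearMap.le_def] at h ⊢
  convert h.adjoint_conj (inrL2 E F) using 1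
  ext y
  simp [blockOp_apply]

end BlockOperators

theorem cfc_conj_symmetry {E : Type} [NormedAddCommGroup E] [InnerProductSpace ℂ E]
    [CompleteSpace E] {f : ℝ → ℝ} {A S : E →L[ℂ] E} (hA : IsSelfAdjoint A)
    (hf : ContinuousOn f (spectrum ℝ A)) (hS : IsSelfAdjoint S) (hSS : S * S = 1) :
    cfc f (S * A * S) = S * cfc f A * S := by
  let u : unitary (E →L[ℂ] E) := ⟨S, by simp [Unitary.mem_iff, hS.star_eq, hSS]⟩
  have hu (T : E →L[ℂ] E) : Unitary.conjStarAlgAut ℂ (E →L[ℂ] E) u T = S * T * S := by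
    simp [u, Unitary.conjStarAlgAut_apply, hS.star_eq]
  rw [← hu, ← hu]
  refine (StarAlgHomClass.map_cfc (S := ℂ) _ f A hf ?_ hA ?_).symm
  · simp only [funext hu]
    fun_prop
  · rw [hu]
    simpa [hS.star_eq] using hA.conjugate S

/-- Compressing to a corner decreases an operator convex function, by averaging over the
reflection `1 ⊕ -1`. -/
theorem OperatorConvexOn.cfc_corner_le {E F : Type} [NormedAddCommGroup E]
    [InnerProductSpace ℂ E] [CompleteSpace E] [NormedAddCommGroup F] [InnerProductSpace ℂ F]
    [CompleteSpace F] {f : ℝ → ℝ} (hf : OperatorConvexOn f)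
    (hfc : ContinuousOn f (Set.Ici (0 : ℝ))) {a a' : E →L[ℂ] E} {b b' : F →L[ℂ] E}
    {c c' : E →L[ℂ] F} {d d' : F →L[ℂ] F} (h : 0 ≤ blockOp a b c d) (ha : 0 ≤ a) (hd : 0 ≤ d)
    (hfh : cfc f (blockOp a b c d) = blockOp a' b' c' d') : cfc f d ≤ d' := by
  let W := blockOp (1 : E →L[ℂ] E) 0 0 (-1 : F →L[ℂ] F)
  have hW : IsSelfAdjoint W := by
    simp [W, isSelfAdjoint_iff, star_blockOp]
  have hWW : W * W = 1 := by
    simp [W, blockOp_mul, ← ContinuousLinearMap.mul_def, blockOp_one]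
  have average (a : E →L[ℂ] E) (b : F →L[ℂ] E) (c : E →L[ℂ] F) (d : F →L[ℂ] F) :
      (1 / 2 : ℝ) • blockOp a b c d + (1 - 1 / 2 : ℝ) • (W * blockOp a b c d * W) =
        blockOp a 0 0 d := by
    have : W * blockOp a b c d * W = blockOp a (-b) (-c) d := by
      simp [W, blockOp_mul, ContinuousLinearMap.one_def]
    rw [this, blockOp_smul, blockOp_smul, blockOp_add]
    congr 1 <;> module
  have h' := hW.conjugate_nonneg h
  have key := hf _ _ _ (.of_nonneg h) (.of_nonneg h') (spectrum_subset_Ici h)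
    (spectrum_subset_Ici h') (1 / 2) (by norm_num)
  rw [average, cfc_blockOp_diag (.of_nonneg ha) (.of_nonneg hd)
    (hfc.mono (Set.union_subset (spectrum_subset_Ici ha) (spectrum_subset_Ici hd))),
    cfc_conj_symmetry (.of_nonneg h) (hfc.mono (spectrum_subset_Ici h)) hW hWW, hfh,
    average] at key
  exact le_of_blockOp_le key

/-- Jensen's operator inequality for compression by an isometry (Hansen-Pedersen). -/
theorem OperatorConvexOn.cfc_isometry_conj_le {E F : Type} [NormedAddCommGroup E]
    [InnerProductSpace ℂ E] [CompleteSpace E] [NormedAddCommGroup F] [InnerProductSpace ℂ F]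
    [CompleteSpace F] {f : ℝ → ℝ} (hf : OperatorConvexOn f)
    (hfc : ContinuousOn f (Set.Ici (0 : ℝ))) {X : E →L[ℂ] E} (hX : 0 ≤ X) {V : F →L[ℂ] E}
    (hV : V.adjoint ∘L V = 1) :
    cfc f (V.adjoint ∘L X ∘L V) ≤ V.adjoint ∘L cfc f X ∘L V := by
  set P : E →L[ℂ] E := 1 - V ∘L V.adjoint with hP
  have hPsa : star P = P := by
    simp [hP, ContinuousLinearMap.star_eq_adjoint, ContinuousLinearMap.adjoint_comp]
  have hVV (x : F) : V.adjoint (V x) = x := congrArg (fun T : F →L[ℂ] F => T x) hV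
  have hPV : P ∘L V = 0 := by ext x; simp [hP, hVV]
  have hVP : V.adjoint ∘L P = 0 := by ext x; simp [hP, hVV]
  have hPP : P ∘L P + V ∘L V.adjoint = 1 := by ext x; simp [hP, hVV]
  have hPXP : 0 ≤ P ∘L X ∘L P := by
    have := star_left_conjugate_nonneg hX P
    rwa [hPsa, mul_assoc] at this
  have hVXV : 0 ≤ V.adjoint ∘L X ∘L V := by
    rw [ContinuousLinearMap.nonneg_iff_isPositive] at hX ⊢
    exact hX.adjoint_conj V
  let S := blockOp P V V.adjoint (0 : F →L[ℂ] F)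
  have hS : IsSelfAdjoint S := by
    simp [S, isSelfAdjoint_iff, star_blockOp, hPsa]
  have hSS : S * S = 1 := by
    simp [S, blockOp_mul, hPP, hPV, hVP, hV, blockOp_one]
  have conj (Y : E →L[ℂ] E) (Z : F →L[ℂ] F) : S * blockOp Y 0 0 Z * S =
      blockOp (P ∘L Y ∘L P + V ∘L Z ∘L V.adjoint) (P ∘L Y ∘L V) (V.adjoint ∘L Y ∘L P)
        (V.adjoint ∘L Y ∘L V) := by
    simp [S, blockOp_mul, ContinuousLinearMap.comp_assoc]
  have hA : 0 ≤ blockOp X 0 0 (0 : F →L[ℂ] F) := blockOp_diag_nonneg hX le_rfl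
  have hB := hS.conjugate_nonneg hA
  have hfB := cfc_conj_symmetry (.of_nonneg hA) (hfc.mono (spectrum_subset_Ici hA)) hS hSS
  rw [cfc_blockOp_diag (.of_nonneg hX) (.zero _)
    (hfc.mono (Set.union_subset (spectrum_subset_Ici hX) (spectrum_subset_Ici le_rfl))),
    conj, conj] at hfB
  rw [conj] at hB
  exact hf.cfc_corner_le hfc hB (by simpa using hPXP) hVXV hfB

section Perspective

variable {E : Type} [NormedAddCommGroup E] [InnerProductSpace ℂ E] [CompleteSpace E]

/-- Jensen's operator inequality for an operator convex combination of two operators. -/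
theorem OperatorConvexOn.cfc_add_conj_le {f : ℝ → ℝ} (hf : OperatorConvexOn f)
    (hfc : ContinuousOn f (Set.Ici (0 : ℝ))) {X Y T U : E →L[ℂ] E} (hX : 0 ≤ X) (hY : 0 ≤ Y)
    (hTU : star T * T + star U * U = 1) :
    cfc f (star T * X * T + star U * Y * U) ≤ star T * cfc f X * T + star U * cfc f Y * U := by
  let V := inlL2 E E ∘L T + inrL2 E E ∘L U
  have hV (Z Z' : E →L[ℂ] E) :
      V.adjoint ∘L blockOp Z 0 0 Z' ∘L V = star T * Z * T + star U * Z' * U := by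
    ext x
    simp [V, blockOp_apply, ContinuousLinearMap.adjoint_comp, ContinuousLinearMap.star_eq_adjoint]
  have hV1 : V.adjoint ∘L V = 1 := by
    have := hV 1 1
    rw [blockOp_one] at this
    rwa [mul_one, mul_one, hTU] at this
  have := hf.cfc_isometry_conj_le hfc (blockOp_diag_nonneg hX hY) hV1
  rwa [cfc_blockOp_diag (.of_nonneg hX) (.of_nonneg hY)
    (hfc.mono (Set.union_subset (spectrum_subset_Ici hX) (spectrum_subset_Ici hY))),
    hV, hV] at this

theorem isSelfAdjoint_opSqrt (R : E →L[ℂ] E) : IsSelfAdjoint (opSqrt R) :=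
  cfc_predicate _ _

theorem isSelfAdjoint_opInvSqrt (R : E →L[ℂ] E) : IsSelfAdjoint (opInvSqrt R) :=
  cfc_predicate _ _

theorem opSqrt_mul_self {R : E →L[ℂ] E} (hR : 0 ≤ R) : opSqrt R * opSqrt R = R := by
  have hsa := IsSelfAdjoint.of_nonneg hR
  rw [opSqrt, ← cfc_mul _ _ R]
  conv_rhs => rw [← cfc_id ℝ R]
  exact cfc_congr fun x hx => Real.mul_self_sqrt (spectrum_nonneg_of_nonneg hR hx)

theorem continuousOn_inv_sqrt {R : E →L[ℂ] E} (hR : IsStrictlyPositive R) :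
    ContinuousOn (fun t : ℝ => (Real.sqrt t)⁻¹) (spectrum ℝ R) :=
  Real.continuous_sqrt.continuousOn.inv₀ fun _ hx =>
    (Real.sqrt_pos.2 (hR.spectrum_pos hx)).ne'

theorem opSqrt_mul_opInvSqrt {R : E →L[ℂ] E} (hR : IsStrictlyPositive R) :
    opSqrt R * opInvSqrt R = 1 := by
  have hsa := hR.isSelfAdjoint
  rw [opSqrt, opInvSqrt, ← cfc_mul _ _ R (by fun_prop) (continuousOn_inv_sqrt hR)]
  conv_rhs => rw [← cfc_one ℝ R]
  exact cfc_congr fun x hx => mul_inv_cancel₀ (Real.sqrt_pos.2 (hR.spectrum_pos hx)).ne'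

theorem opInvSqrt_mul_opSqrt {R : E →L[ℂ] E} (hR : IsStrictlyPositive R) :
    opInvSqrt R * opSqrt R = 1 := by
  simpa [(isSelfAdjoint_opSqrt R).star_eq, (isSelfAdjoint_opInvSqrt R).star_eq] using
    congrArg star (opSqrt_mul_opInvSqrt hR)

/-- The perspective of an operator convex function is subadditive. -/
theorem OperatorConvexOn.persp_add_le {f : ℝ → ℝ} (hf : OperatorConvexOn f)
    (hfc : ContinuousOn f (Set.Ici (0 : ℝ))) {L₁ L₂ R₁ R₂ : E →L[ℂ] E} (hL₁ : 0 ≤ L₁)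
    (hL₂ : 0 ≤ L₂) (hR₁ : IsStrictlyPositive R₁) (hR₂ : IsStrictlyPositive R₂) :
    persp f (L₁ + L₂) (R₁ + R₂) ≤ persp f L₁ R₁ + persp f L₂ R₂ := by
  have hR : IsStrictlyPositive (R₁ + R₂) := hR₁.add_nonneg hR₂.nonneg
  set q := opSqrt (R₁ + R₂) with hq
  set p := opInvSqrt (R₁ + R₂) with hp
  have hps : star p = p := (isSelfAdjoint_opInvSqrt _).star_eq
  have hpq : p * q = 1 := opInvSqrt_mul_opSqrt hR
  have hqp : q * p = 1 := opSqrt_mul_opInvSqrt hR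
  have hqq : q * q = R₁ + R₂ := opSqrt_mul_self hR.nonneg
  have cancel {R : E →L[ℂ] E} (hR : IsStrictlyPositive R) (Z : E →L[ℂ] E) :
      star (opSqrt R * p) * (opInvSqrt R * Z * opInvSqrt R) * (opSqrt R * p) = p * Z * p := by
    rw [star_mul, hps, (isSelfAdjoint_opSqrt R).star_eq]
    calc _ = p * (opSqrt R * opInvSqrt R) * Z * (opInvSqrt R * opSqrt R) * p := by noncomm_ring
      _ = _ := by rw [opSqrt_mul_opInvSqrt hR, opInvSqrt_mul_opSqrt hR, mul_one, mul_one]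
  have expand (R Z : E →L[ℂ] E) :
      q * (star (opSqrt R * p) * Z * (opSqrt R * p)) * q = opSqrt R * Z * opSqrt R := by
    rw [star_mul, hps, (isSelfAdjoint_opSqrt R).star_eq]
    calc _ = (q * p) * opSqrt R * Z * opSqrt R * (p * q) := by noncomm_ring
      _ = _ := by rw [hqp, hpq, one_mul, mul_one]
  have hsq {R : E →L[ℂ] E} (hR : IsStrictlyPositive R) :
      star (opSqrt R * p) * (opSqrt R * p) = p * R * p := by
    rw [star_mul, hps, (isSelfAdjoint_opSqrt R).star_eq]
    calc _ = p * (opSqrt R * opSqrt R) * p := by noncomm_ring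
      _ = _ := by rw [opSqrt_mul_self hR.nonneg]
  have hiso : star (opSqrt R₁ * p) * (opSqrt R₁ * p) + star (opSqrt R₂ * p) * (opSqrt R₂ * p)
      = 1 := by
    rw [hsq hR₁, hsq hR₂, ← add_mul, ← mul_add, ← hqq]
    calc _ = (p * q) * (q * p) := by noncomm_ring
      _ = 1 := by rw [hpq, hqp, one_mul]
  have key := hf.cfc_add_conj_le hfc ((isSelfAdjoint_opInvSqrt R₁).conjugate_nonneg hL₁)
    ((isSelfAdjoint_opInvSqrt R₂).conjugate_nonneg hL₂) hiso
  rw [cancel hR₁, cancel hR₂, ← add_mul, ← mul_add] at key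
  have := (isSelfAdjoint_opSqrt (R₁ + R₂)).conjugate_le_conjugate key
  rwa [← hq, mul_add q, add_mul _ _ q, expand, expand] at this

/-- The perspective is positively homogeneous. -/
theorem persp_smul (f : ℝ → ℝ) (L : E →L[ℂ] E) {R : E →L[ℂ] E} (hR : IsStrictlyPositive R)
    {t : ℝ} (ht : 0 < t) : persp f (t • L) (t • R) = t • persp f L R := by
  have hsa := hR.isSelfAdjoint
  have hst := Real.mul_self_sqrt ht.le
  have h₁ : opSqrt (t • R) = Real.sqrt t • opSqrt R := by
    rw [opSqrt, opSqrt, ← cfc_comp_const_mul t Real.sqrt R Real.continuous_sqrt.continuousOn hsa,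
      ← cfc_smul _ _ R Real.continuous_sqrt.continuousOn]
    simp [Real.sqrt_mul ht.le]
  have h₂ : opInvSqrt (t • R) = (Real.sqrt t)⁻¹ • opInvSqrt R := by
    rw [opInvSqrt, opInvSqrt, ← cfc_comp_const_mul t (fun x => (Real.sqrt x)⁻¹) R ?_ hsa,
      ← cfc_smul _ _ R (continuousOn_inv_sqrt hR)]
    · simp [Real.sqrt_mul ht.le, mul_comm]
    · rintro _ ⟨x, hx, rfl⟩
      refine (Real.continuous_sqrt.continuousAt.inv₀ ?_).continuousWithinAt
      exact (Real.sqrt_pos.2 (mul_pos ht (hR.spectrum_pos hx))).ne'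
  have h₃ : (Real.sqrt t)⁻¹ * (t * (Real.sqrt t)⁻¹) = 1 := by
    field_simp
    rw [sq, hst]
  simp only [persp, h₁, h₂, smul_mul_assoc, mul_smul_comm, smul_smul, h₃, one_smul, hst]

/-- The perspective of an operator convex function is subadditive over finite sums. -/
theorem OperatorConvexOn.persp_sum_le {f : ℝ → ℝ} (hf : OperatorConvexOn f)
    (hfc : ContinuousOn f (Set.Ici (0 : ℝ))) {ι : Type*} {L R : ι → E →L[ℂ] E}
    (hL : ∀ i, 0 ≤ L i) (hR : ∀ i, IsStrictlyPositive (R i)) {s : Finset ι} (hs : s.Nonempty) :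
    IsStrictlyPositive (∑ i ∈ s, R i) ∧
      persp f (∑ i ∈ s, L i) (∑ i ∈ s, R i) ≤ ∑ i ∈ s, persp f (L i) (R i) := by
  induction hs using Finset.Nonempty.cons_induction with
  | singleton i => simpa using hR i
  | cons i s hi hs ih =>
    simp only [Finset.sum_cons]
    exact ⟨(hR i).add_nonneg ih.1.nonneg,
      (hf.persp_add_le hfc (hL i) (Finset.sum_nonneg fun j _ => hL j) (hR i) ih.1).trans
        (by gcongr; exact ih.2)⟩

end Perspective


/-- For a partition `{1,…,n} = S₁ ∪ S₂`:
`2 g(A/2, B/2) ≤ g(A_{S₁}, B_{S₁}) + g(A_{S₂}, B_{S₂}) ≤ ∑ i, g(L i, R i)`. -/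
theorem stmt_3 (f : ℝ → ℝ) (hf_cont : ContinuousOn f (Set.Ici (0 : ℝ)))
    (hf : OperatorConvexOn f) (n : ℕ)
    (L R : Fin n → H →L[ℂ] H)
    (hL : ∀ i, 0 ≤ L i) (hR : ∀ i, 0 ≤ R i ∧ IsUnit (R i))
    (S₁ S₂ : Finset (Fin n)) (hdisj : Disjoint S₁ S₂) (hcover : S₁ ∪ S₂ = Finset.univ)
    (hne₁ : S₁.Nonempty) (hne₂ : S₂.Nonempty)
    (hB₁ : IsUnit (∑ i ∈ S₁, R i)) (hB₂ : IsUnit (∑ i ∈ S₂, R i)) :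
    (2 : ℝ) • persp f ((1 / 2 : ℝ) • ∑ i, L i) ((1 / 2 : ℝ) • ∑ i, R i) ≤
        persp f (∑ i ∈ S₁, L i) (∑ i ∈ S₁, R i) + persp f (∑ i ∈ S₂, L i) (∑ i ∈ S₂, R i) ∧
      persp f (∑ i ∈ S₁, L i) (∑ i ∈ S₁, R i) + persp f (∑ i ∈ S₂, L i) (∑ i ∈ S₂, R i) ≤
        ∑ i, persp f (L i) (R i) := by
  have hR' (i) : IsStrictlyPositive (R i) := (hR i).2.isStrictlyPositive (hR i).1
  obtain ⟨hP₁, hle₁⟩ := hf.persp_sum_le hf_cont hL hR' hne₁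
  obtain ⟨hP₂, hle₂⟩ := hf.persp_sum_le hf_cont hL hR' hne₂
  rw [← hcover, Finset.sum_union hdisj, Finset.sum_union hdisj, Finset.sum_union hdisj]
  refine ⟨?_, add_le_add hle₁ hle₂⟩
  rw [persp_smul f _ (hP₁.add_nonneg hP₂.nonneg) (by norm_num), smul_smul,
    show (2 : ℝ) * (1 / 2) = 1 by norm_num, one_smul]
  exact hf.persp_add_le hf_cont (Finset.sum_nonneg fun i _ => hL i)
    (Finset.sum_nonneg fun i _ => hL i) hP₁ hP₂
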